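/- Let H be a complex Hilbert space, n ≥ 1, and Z : Fin n → (H →L[ℂ] H) with ‖Zᵢ‖ < 1 for every i. Then ‖Φ_Z‖ < 1 (indeed ‖Φ_Z(a)‖ ≤ (max_i ‖Zᵢ‖)² ‖a‖), the map id − Φ_Z is a bijection of Mₙ(B(H)) onto itself, and its inverse (id − Φ_Z)⁻¹ = ∑ₖ Φ_Zᵏ is completely positive. -/

import Mathlib

/-!
STATEMENT 6: Let H be a complex Hilbert space, n ≥ 1, and Z : Fin n → (H →L[ℂ] H) with
‖Zᵢ‖ < 1 for every i.  Then ‖Φ_Z‖ < 1 (indeed ‖Φ_Z(a)‖ ≤ (max_i ‖Zᵢ‖)² ‖a‖), the map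
id − Φ_Z is a bijection of Mₙ(B(H)) onto itself, and its inverse (id − Φ_Z)⁻¹ = ∑ₖ Φ_Zᵏ is
completely positive.

The C*-norm of a matrix `a ∈ Mₙ(B(H))` is `‖toOp a‖`, the operator norm of its canonical
action on the Hilbert space `H^n = PiLp 2 (fun _ : Fin n => H)`; the norm statements and the
summability statement `(id − Φ_Z)⁻¹ b = ∑ₖ Φ_Zᵏ b` are expressed via this (isometric)
identification.  The inverse map is quantified as any two-sided function inverse of
`id − Φ_Z` (which is unique).  Positivity in matrix algebras over B(H) is expressed by the
C*-characterization `∃ b, a = star b * b`.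
-/

open ContinuousLinearMap

/-- The entrywise amplification of a map to `k × k` matrices. -/
def ampl {A B : Type*} (k : ℕ) (f : A → B) (a : Matrix (Fin k) (Fin k) A) :
    Matrix (Fin k) (Fin k) B :=
  Matrix.of fun i j => f (a i j)

/-- Nonnegativity in a matrix algebra over a C*-algebra, via the characterization of the
positive cone as `{star b * b}`. -/
def StarNonneg {A : Type*} [Mul A] [Star A] (a : A) : Prop :=
  ∃ b, a = star b * b

/-- A map between C*-algebras is completely positive if all of its matrix amplifications map
nonnegative elements to nonnegative elements. -/
def CompletelyPositive {A B : Type*} [NonUnitalNonAssocSemiring A] [Star A]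
    [NonUnitalNonAssocSemiring B] [Star B] (f : A → B) : Prop :=
  ∀ k : ℕ, 1 ≤ k → ∀ a : Matrix (Fin k) (Fin k) A,
    StarNonneg a → StarNonneg (ampl k f a)

variable {H : Type*} [NormedAddCommGroup H] [InnerProductSpace ℂ H] [CompleteSpace H]

/-- The map `Φ_Z : a ↦ (Zᵢ ∘ aᵢⱼ ∘ Zⱼ*)` on `Mₙ(B(H))` determined by an `n`-tuple `Z` of
operators on `H`. -/
noncomputable def PhiMap {n : ℕ} (Z : Fin n → H →L[ℂ] H)
    (a : Matrix (Fin n) (Fin n) (H →L[ℂ] H)) : Matrix (Fin n) (Fin n) (H →L[ℂ] H) :=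
  Matrix.of fun i j => Z i ∘L a i j ∘L ContinuousLinearMap.adjoint (Z j)

/-- The canonical action of a matrix of operators on the Hilbert space direct sum
`K^m = PiLp 2 (fun _ : Fin m => K)`: `(toOp q) h i = ∑ j, q i j (h j)`.  This realizes the
isometric *-isomorphism `Mₘ(B(K)) ≃ B(K^m)` giving `Mₘ(B(K))` its C*-norm. -/
noncomputable def toOp {K : Type*} [NormedAddCommGroup K] [InnerProductSpace ℂ K] {m : ℕ}
    (q : Matrix (Fin m) (Fin m) (K →L[ℂ] K)) :
    PiLp 2 (fun _ : Fin m => K) →L[ℂ] PiLp 2 (fun _ : Fin m => K) :=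
  (PiLp.continuousLinearEquiv 2 ℂ (fun _ : Fin m => K)).symm.toContinuousLinearMap ∘L
    (ContinuousLinearMap.pi fun i => ∑ j, (q i j) ∘L (ContinuousLinearMap.proj j) ∘L
      (PiLp.continuousLinearEquiv 2 ℂ (fun _ : Fin m => K)).toContinuousLinearMap)

theorem HasSum.map_of_continuous_of_add {A E ι : Type*} [AddCommGroup A] [TopologicalSpace A]
    [AddCommGroup E] [TopologicalSpace E] {f : ι → A} {a : A} (hf : HasSum f a) (g : A → E)
    (hg : Continuous g) (hadd : ∀ x y, g (x + y) = g x + g y) :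
    HasSum (fun k => g (f k)) (g a) :=
  hf.map (AddMonoidHom.mk' g hadd) hg

section ToOp

variable {K : Type*} [NormedAddCommGroup K] [InnerProductSpace ℂ K] {m : ℕ}

theorem toOp_apply (q : Matrix (Fin m) (Fin m) (K →L[ℂ] K))
    (h : PiLp 2 (fun _ : Fin m => K)) (i : Fin m) :
    toOp q h i = ∑ j, q i j (h j) := by
  simp [toOp]

theorem toOp_add (p q : Matrix (Fin m) (Fin m) (K →L[ℂ] K)) :
    toOp (p + q) = toOp p + toOp q := by
  ext h i
  simp [toOp_apply, Finset.sum_add_distrib]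

theorem continuous_toOp :
    Continuous (toOp : Matrix (Fin m) (Fin m) (K →L[ℂ] K) → _) := by
  have key : (toOp : Matrix (Fin m) (Fin m) (K →L[ℂ] K) → _) = fun q => ∑ i, ∑ j,
      (PiLp.continuousLinearEquiv 2 ℂ (fun _ : Fin m => K)).symm.toContinuousLinearMap ∘L
        (ContinuousLinearMap.single ℂ (fun _ : Fin m => K) i) ∘L (q i j) ∘L
        (ContinuousLinearMap.proj j) ∘L
        (PiLp.continuousLinearEquiv 2 ℂ (fun _ : Fin m => K)).toContinuousLinearMap := by
    funext q
    ext h i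
    simp [toOp_apply, Pi.single_apply]
  have : ContinuousAdd (PiLp 2 (fun _ : Fin m => K) →L[ℂ] PiLp 2 (fun _ : Fin m => K)) :=
    IsTopologicalAddGroup.toContinuousAdd
  rw [key]
  refine continuous_finsetSum _ fun i _ => continuous_finsetSum _ fun j _ => ?_
  have hq : Continuous fun q : Matrix (Fin m) (Fin m) (K →L[ℂ] K) => q i j :=
    continuous_id.matrix_elem i j
  exact continuous_const.clm_comp (continuous_const.clm_comp (hq.clm_comp continuous_const))

theorem toOp_diagonal_apply (W : Fin m → K →L[ℂ] K)
    (h : PiLp 2 (fun _ : Fin m => K)) (i : Fin m) :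
    toOp (Matrix.diagonal W) h i = W i (h i) := by
  rw [toOp_apply, Finset.sum_eq_single i] <;> simp +contextual [eq_comm]

theorem norm_toOp_diagonal_le (W : Fin m → K →L[ℂ] K) {M : ℝ} (hM : 0 ≤ M)
    (hW : ∀ i, ‖W i‖ ≤ M) : ‖toOp (Matrix.diagonal W)‖ ≤ M := by
  refine ContinuousLinearMap.opNorm_le_bound _ hM fun h => ?_
  refine le_of_sq_le_sq ?_ (by positivity)
  rw [mul_pow, PiLp.norm_sq_eq_of_L2, PiLp.norm_sq_eq_of_L2, Finset.mul_sum]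
  refine Finset.sum_le_sum fun i _ => ?_
  rw [toOp_diagonal_apply, ← mul_pow]
  exact pow_le_pow_left₀ (norm_nonneg _) ((W i).le_of_opNorm_le (hW i) _) 2

theorem HasSum.toOp {ι : Type*} {f : ι → Matrix (Fin m) (Fin m) (K →L[ℂ] K)}
    {a : Matrix (Fin m) (Fin m) (K →L[ℂ] K)} (hf : HasSum f a) :
    HasSum (fun k => _root_.toOp (f k)) (_root_.toOp a) :=
  hf.map_of_continuous_of_add _root_.toOp continuous_toOp toOp_add

end ToOp

section PhiMap

variable {n : ℕ}

theorem toOp_phiMap (Z : Fin n → H →L[ℂ] H) (a : Matrix (Fin n) (Fin n) (H →L[ℂ] H)) :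
    toOp (PhiMap Z a) = toOp (Matrix.diagonal Z) ∘L toOp a ∘L
      toOp (Matrix.diagonal fun i => adjoint (Z i)) := by
  ext h i
  simp only [ContinuousLinearMap.comp_apply, toOp_diagonal_apply]
  rw [toOp_apply, toOp_apply]
  simp [toOp_diagonal_apply, PhiMap]

theorem norm_toOp_phiMap_le (Z : Fin n → H →L[ℂ] H)
    (a : Matrix (Fin n) (Fin n) (H →L[ℂ] H)) :
    ‖toOp (PhiMap Z a)‖ ≤ (⨆ i, ‖Z i‖) ^ 2 * ‖toOp a‖ := by
  have h0 : 0 ≤ ⨆ i, ‖Z i‖ := Real.iSup_nonneg fun i => norm_nonneg _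
  have hle (i : Fin n) : ‖Z i‖ ≤ ⨆ i, ‖Z i‖ := le_ciSup (f := fun i => ‖Z i‖) (Set.finite_range _).bddAbove i
  have h1 := norm_toOp_diagonal_le Z h0 hle
  have h2 := norm_toOp_diagonal_le (fun i => adjoint (Z i)) h0 fun i => by simpa using hle i
  rw [toOp_phiMap]
  calc _ ≤ ‖toOp (Matrix.diagonal Z)‖ *
        (‖toOp a‖ * ‖toOp (Matrix.diagonal fun i => adjoint (Z i))‖) :=
        (opNorm_comp_le _ _).trans (by gcongr; exact opNorm_comp_le _ _)
    _ ≤ (⨆ i, ‖Z i‖) * (‖toOp a‖ * (⨆ i, ‖Z i‖)) := by gcongr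
    _ = _ := by ring

/-- The map `x ↦ Zᵢ x Zⱼ*` induced by `PhiMap Z` on the `(i, j)` entry. -/
noncomputable def phiEntry (Z : Fin n → H →L[ℂ] H) (i j : Fin n) :
    (H →L[ℂ] H) →L[ℂ] (H →L[ℂ] H) :=
  ContinuousLinearMap.mulLeftRight ℂ (H →L[ℂ] H) (Z i) (adjoint (Z j))

theorem phiMap_apply (Z : Fin n → H →L[ℂ] H) (a : Matrix (Fin n) (Fin n) (H →L[ℂ] H))
    (i j : Fin n) : PhiMap Z a i j = phiEntry Z i j (a i j) := by
  simp [PhiMap, phiEntry, ContinuousLinearMap.mul_def, ContinuousLinearMap.comp_assoc]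

theorem phiMap_iterate_apply (Z : Fin n → H →L[ℂ] H) (k : ℕ)
    (a : Matrix (Fin n) (Fin n) (H →L[ℂ] H)) (i j : Fin n) :
    (PhiMap Z)^[k] a i j = (phiEntry Z i j ^ k) (a i j) := by
  induction k with
  | zero => simp
  | succ k ih => rw [Function.iterate_succ_apply', phiMap_apply, ih, pow_succ']; rfl

theorem norm_phiEntry_lt_one {Z : Fin n → H →L[ℂ] H} (hZ : ∀ i, ‖Z i‖ < 1) (i j : Fin n) :
    ‖phiEntry Z i j‖ < 1 := by
  refine (ContinuousLinearMap.opNorm_mulLeftRight_apply_apply_le ℂ (H →L[ℂ] H) _ _).trans_lt ?_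
  rw [LinearIsometryEquiv.norm_map]
  exact mul_lt_one_of_nonneg_of_lt_one_left (norm_nonneg _) (hZ i) (hZ j).le

theorem bijective_sub_phiMap {Z : Fin n → H →L[ℂ] H} (hZ : ∀ i, ‖Z i‖ < 1) :
    Function.Bijective (fun a : Matrix (Fin n) (Fin n) (H →L[ℂ] H) => a - PhiMap Z a) := by
  constructor
  · intro a b hab
    ext1 i j
    have h : (1 - phiEntry Z i j) (a i j) = (1 - phiEntry Z i j) (b i j) := by
      simpa [phiMap_apply] using congrFun (congrFun hab i) j
    have hinv := geom_series_mul_neg _ (norm_phiEntry_lt_one hZ i j)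
    have := congrArg (∑' k : ℕ, phiEntry Z i j ^ k : (H →L[ℂ] H) →L[ℂ] (H →L[ℂ] H)) h
    rwa [← mul_apply_eq_comp, ← mul_apply_eq_comp, hinv] at this
  · intro b
    refine ⟨Matrix.of fun i j => (∑' k : ℕ, phiEntry Z i j ^ k) (b i j), ?_⟩
    ext1 i j
    have hinv := mul_neg_geom_series _ (norm_phiEntry_lt_one hZ i j)
    have := congrArg (fun T : (H →L[ℂ] H) →L[ℂ] (H →L[ℂ] H) => T (b i j)) hinv
    simpa [phiMap_apply] using this

theorem hasSum_phiMap_iterate {Z : Fin n → H →L[ℂ] H} (hZ : ∀ i, ‖Z i‖ < 1)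
    (a : Matrix (Fin n) (Fin n) (H →L[ℂ] H)) :
    HasSum (fun k : ℕ => (PhiMap Z)^[k] (a - PhiMap Z a)) a := by
  refine Pi.hasSum.2 fun i => Pi.hasSum.2 fun j => ?_
  have hT := norm_phiEntry_lt_one hZ i j
  have hs := (summable_geometric_of_norm_lt_one hT).hasSum.mapL
    (ContinuousLinearMap.apply ℂ (H →L[ℂ] H) ((1 - phiEntry Z i j) (a i j)))
  have hlim : (∑' k : ℕ, phiEntry Z i j ^ k) ((1 - phiEntry Z i j) (a i j)) = a i j := by
    rw [← mul_apply_eq_comp, geom_series_mul_neg _ hT]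
    rfl
  have hf (k : ℕ) : (PhiMap Z)^[k] (a - PhiMap Z a) i j =
      (phiEntry Z i j ^ k) ((1 - phiEntry Z i j) (a i j)) := by
    rw [phiMap_iterate_apply]
    simp [phiMap_apply]
  simp only [hf]
  simpa only [ContinuousLinearMap.apply_apply, hlim] using hs

theorem phiMap_eq_diagonal_mul (Z : Fin n → H →L[ℂ] H)
    (a : Matrix (Fin n) (Fin n) (H →L[ℂ] H)) :
    PhiMap Z a = star (Matrix.diagonal fun j => adjoint (Z j)) * a *
      Matrix.diagonal fun j => adjoint (Z j) := by
  ext1 i j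
  rw [Matrix.star_eq_conjTranspose, Matrix.diagonal_conjTranspose, Matrix.mul_diagonal,
    Matrix.diagonal_mul]
  simp [PhiMap, ContinuousLinearMap.star_eq_adjoint, ContinuousLinearMap.mul_def,
    ContinuousLinearMap.comp_assoc]

theorem StarNonneg.ampl_phiMap (Z : Fin n → H →L[ℂ] H) {k : ℕ}
    {a : Matrix (Fin k) (Fin k) (Matrix (Fin n) (Fin n) (H →L[ℂ] H))} (ha : StarNonneg a) :
    StarNonneg (ampl k (PhiMap Z) a) := by
  obtain ⟨b, rfl⟩ := ha
  refine ⟨Matrix.of fun p q => b p q * Matrix.diagonal fun j => adjoint (Z j), ?_⟩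
  ext1 p q
  simp only [ampl, phiMap_eq_diagonal_mul, Matrix.of_apply, Matrix.mul_apply, Matrix.star_apply,
    star_mul, Finset.mul_sum, Finset.sum_mul, mul_assoc]

theorem StarNonneg.ampl_phiMap_iterate (Z : Fin n → H →L[ℂ] H) {k : ℕ} (m : ℕ)
    {a : Matrix (Fin k) (Fin k) (Matrix (Fin n) (Fin n) (H →L[ℂ] H))} (ha : StarNonneg a) :
    StarNonneg (ampl k (PhiMap Z)^[m] a) := by
  induction m with
  | zero => exact ha
  | succ m ih =>
    rw [Function.iterate_succ']
    exact ih.ampl_phiMap Z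

theorem starNonneg_of_hasSum {A ι : Type*} [NonUnitalCStarAlgebra A] [PartialOrder A]
    [StarOrderedRing A] {f : ι → A} {a : A} (hf : HasSum f a) (h : ∀ m, StarNonneg (f m)) :
    StarNonneg a := by
  simp only [StarNonneg, ← CStarAlgebra.nonneg_iff_eq_star_mul_self] at h ⊢
  exact hf.nonneg h

theorem starNonneg_matrix_of_hasSum {k : ℕ} {ι : Type*}
    {f : ι → Matrix (Fin k) (Fin k) (Matrix (Fin n) (Fin n) (H →L[ℂ] H))}
    {a : Matrix (Fin k) (Fin k) (Matrix (Fin n) (Fin n) (H →L[ℂ] H))}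
    (hf : HasSum f a) (h : ∀ m, StarNonneg (f m)) : StarNonneg a :=
  starNonneg_of_hasSum
    (A := CStarMatrix (Fin k) (Fin k) (CStarMatrix (Fin n) (Fin n) (H →L[ℂ] H))) hf h

end PhiMap

theorem one_sub_phiMap_bijective_and_inverse_completelyPositive
    {n : ℕ} (hn : 1 ≤ n) (Z : Fin n → H →L[ℂ] H) (hZ : ∀ i, ‖Z i‖ < 1) :
    (∀ a : Matrix (Fin n) (Fin n) (H →L[ℂ] H),
        ‖toOp (PhiMap Z a)‖ ≤ (⨆ i, ‖Z i‖) ^ 2 * ‖toOp a‖) ∧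
      (∃ C : ℝ, C < 1 ∧ ∀ a : Matrix (Fin n) (Fin n) (H →L[ℂ] H),
        ‖toOp (PhiMap Z a)‖ ≤ C * ‖toOp a‖) ∧
      Function.Bijective
        (fun a : Matrix (Fin n) (Fin n) (H →L[ℂ] H) => a - PhiMap Z a) ∧
      ∀ Q : Matrix (Fin n) (Fin n) (H →L[ℂ] H) → Matrix (Fin n) (Fin n) (H →L[ℂ] H),
        Function.LeftInverse Q (fun a => a - PhiMap Z a) →
        Function.RightInverse Q (fun a => a - PhiMap Z a) →
        (∀ a : Matrix (Fin n) (Fin n) (H →L[ℂ] H),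
            HasSum (fun k : ℕ => toOp ((PhiMap Z)^[k] a)) (toOp (Q a))) ∧
          CompletelyPositive Q := by
  have : Nonempty (Fin n) := ⟨⟨0, hn⟩⟩
  refine ⟨norm_toOp_phiMap_le Z, ⟨(⨆ i, ‖Z i‖) ^ 2, ?_, norm_toOp_phiMap_le Z⟩,
    bijective_sub_phiMap hZ, fun Q _ hQ => ?_⟩
  · obtain ⟨i, hi⟩ := exists_eq_ciSup_of_finite (f := fun i => ‖Z i‖)
    rw [← hi]
    exact pow_lt_one₀ (norm_nonneg _) (hZ i) two_ne_zero
  · have hsum (a : Matrix (Fin n) (Fin n) (H →L[ℂ] H)) :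
        HasSum (fun k : ℕ => (PhiMap Z)^[k] a) (Q a) := by
      have h := hasSum_phiMap_iterate hZ (Q a)
      rwa [show Q a - PhiMap Z (Q a) = a from hQ a] at h
    refine ⟨fun a => (hsum a).toOp,
      fun k _ a ha => ?_⟩
    have hampl : HasSum (fun m : ℕ => ampl k (PhiMap Z)^[m] a) (ampl k Q a) :=
      Pi.hasSum.2 fun p => Pi.hasSum.2 fun q => hsum (a p q)
    exact starNonneg_matrix_of_hasSum hampl fun m => ha.ampl_phiMap_iterate Z m
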